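/- arXiv:2601.03387 — 2 statements merged into one kernel-verified Lean document; each statement's English description precedes it below -/
import Mathlib

section
/- Let W be an Exp(1) random variable and θ an independent U(−π/4, π/4) random variable. Then for every z ≥ 0, P( √(W·(1 − sin 2θ)) ≤ z ) = 1 − 2·Q(z); equivalently, √(W·(1 − sin 2θ)) has the same distribution as |G| for a standard real Gaussian G (the half-normal distribution with density √(2/π)·e^{−z²/2} on z ≥ 0). (The key distributional identity for the 2-bit phase-quantized case, equation (half_normal).) -/
open MeasureTheory ProbabilityTheory Real

/-- The Gaussian Q-function `Q(x) = (1/√(2π)) ∫_x^∞ e^{−t²/2} dt`. -/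
noncomputable def gaussQ (x : ℝ) : ℝ :=
  (Real.sqrt (2 * Real.pi))⁻¹ * ∫ t in Set.Ioi x, Real.exp (-t ^ 2 / 2)

/-- The uniform probability measure on the open interval `(a, b)`. -/
noncomputable def unifOn (a b : ℝ) : Measure ℝ :=
  (ENNReal.ofReal (b - a))⁻¹ • (volume.restrict (Set.Ioo a b))

/-- Half-normal density. -/
noncomputable def hnPdf (y : ℝ) : ℝ := 2 * ((Real.sqrt (2 * π))⁻¹ * Real.exp (-y ^ 2 / 2))

theorem hn_lintegral_abs (g : ℝ → ENNReal) :
    ∫⁻ x, g |x| = 2 * ∫⁻ x in Set.Ioi (0 : ℝ), g x := by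
  have h1 : ∫⁻ x in Set.Ioi (0 : ℝ), g |x| = ∫⁻ x in Set.Ioi (0 : ℝ), g x :=
    setLIntegral_congr_fun measurableSet_Ioi (fun x hx => by
      rw [abs_of_pos hx])
  have h2 : ∫⁻ x in Set.Iic (0 : ℝ), g |x| = ∫⁻ x in Set.Ioi (0 : ℝ), g x := by
    rw [← h1]
    have := lintegral_neg_eq_self (μ := (volume : Measure ℝ))
      ((Set.Iio (0:ℝ)).indicator fun x => g |x|)
    rw [setLIntegral_congr (Iio_ae_eq_Iic (a := (0:ℝ)) (μ := volume)).symm,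
      ← lintegral_indicator measurableSet_Iio, ← this,
      ← lintegral_indicator measurableSet_Ioi]
    congr 1
    ext x
    simp [Set.indicator]
  rw [← lintegral_add_compl _ (measurableSet_Ioi (a := (0:ℝ))), Set.compl_Ioi, h1, h2, two_mul]

theorem hn_gauss (f : ℝ → ENNReal) (hf : Measurable f) :
    ∫⁻ y, f |y| ∂(gaussianReal 0 1) = ∫⁻ y in Set.Ioi (0 : ℝ), ENNReal.ofReal (hnPdf y) * f y := by
  rw [gaussianReal_of_var_ne_zero _ one_ne_zero,
    lintegral_withDensity_eq_lintegral_mul _ (measurable_gaussianPDF 0 1)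
      (g := fun y : ℝ => f |y|) (hf.comp measurable_norm)]
  have h : ∀ y : ℝ, (gaussianPDF 0 1 * fun y : ℝ => f |y|) y
      = (fun y => ENNReal.ofReal ((Real.sqrt (2 * π))⁻¹ * Real.exp (-y ^ 2 / 2)) * f y) |y| := by
    intro y
    simp [gaussianPDF, gaussianPDFReal]
  rw [lintegral_congr h, hn_lintegral_abs
    (fun y => ENNReal.ofReal ((Real.sqrt (2 * π))⁻¹ * Real.exp (-y ^ 2 / 2)) * f y), ← lintegral_const_mul' _ _ (by simp)]
  congr 1; ext y
  rw [hnPdf, ENNReal.ofReal_mul (by norm_num), ← mul_assoc]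
  simp

theorem hn_exp (g : ℝ → ENNReal) (hg : Measurable g) :
    ∫⁻ w, g w ∂(expMeasure 1) = ∫⁻ w in Set.Ioi (0 : ℝ), ENNReal.ofReal (Real.exp (-w)) * g w := by
  have : expMeasure 1 = volume.withDensity (exponentialPDF 1) := rfl
  have hm : Measurable (exponentialPDF 1) := (measurable_exponentialPDFReal 1).ennreal_ofReal
  rw [this, lintegral_withDensity_eq_lintegral_mul _ hm hg,
    setLIntegral_congr (Ioi_ae_eq_Ici (a := (0:ℝ)) (μ := volume)),
    ← lintegral_indicator measurableSet_Ici]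
  congr 1; ext w
  by_cases hw : 0 ≤ w <;> simp [Set.indicator, exponentialPDF_eq, hw]

theorem hn_unif (g : ℝ → ENNReal) :
    ∫⁻ t, g t ∂(unifOn (-(π / 4)) (π / 4)) = ∫⁻ t in Set.Ioi (0 : ℝ),
      ENNReal.ofReal (2 / π * (1 / (1 + t ^ 2))) * g (arctan t - π / 4) := by
  have himg : (fun t => arctan t - π / 4) '' Set.Ioi (0:ℝ) = Set.Ioo (-(π / 4)) (π / 4) := by
    ext x
    simp only [Set.mem_image, Set.mem_Ioi, Set.mem_Ioo]
    constructor
    · rintro ⟨t, ht, rfl⟩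
      have h1 := Real.arctan_pos.2 ht
      have h2 := Real.arctan_lt_pi_div_two t
      constructor <;> linarith
    · rintro ⟨h1, h2⟩
      refine ⟨tan (x + π / 4), Real.tan_pos_of_pos_of_lt_pi_div_two (by linarith) (by linarith), ?_⟩
      rw [Real.arctan_tan (by linarith [Real.pi_pos]) (by linarith)]
      ring
  rw [unifOn, lintegral_smul_measure, ← himg,
    lintegral_image_eq_lintegral_abs_deriv_mul (f' := fun t => 1 / (1 + t ^ 2)) measurableSet_Ioi
      (fun x _ => ((Real.hasDerivAt_arctan x).sub_const _).hasDerivWithinAt)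
      (fun x _ y _ h => Real.arctan_injective (by simpa using h)), smul_eq_mul,
    ← lintegral_const_mul' _ _ (by simp; linarith [Real.pi_pos])]
  congr 1; ext t
  rw [ENNReal.ofReal_mul (by positivity), ← mul_assoc, abs_of_nonneg (by positivity),
    ← ENNReal.ofReal_inv_of_pos (by linarith [Real.pi_pos])]
  congr 4
  field_simp
  norm_num

theorem hn_subst (f : ℝ → ENNReal) (t : ℝ) :
    ∫⁻ w in Set.Ioi (0 : ℝ), ENNReal.ofReal (Real.exp (-w)) * f (√(w * (2 / (1 + t ^ 2))))
      = ∫⁻ y in Set.Ioi (0 : ℝ),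
        ENNReal.ofReal (y * (1 + t ^ 2)) * (ENNReal.ofReal (Real.exp (-(y ^ 2 * (1 + t ^ 2) / 2))) * f y) := by
  have hp : 0 < 1 + t ^ 2 := by positivity
  have himg : (fun y => y ^ 2 * (1 + t ^ 2) / 2) '' Set.Ioi (0:ℝ) = Set.Ioi 0 := by
    ext x
    simp only [Set.mem_image, Set.mem_Ioi]
    constructor
    · rintro ⟨y, hy, rfl⟩; positivity
    · intro hx
      refine ⟨√(x * (2 / (1 + t ^ 2))), by positivity, ?_⟩
      rw [Real.sq_sqrt (by positivity)]
      field_simp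
  conv_lhs => rw [← himg]
  rw [lintegral_image_eq_lintegral_abs_deriv_mul (f' := fun y => y * (1 + t ^ 2)) measurableSet_Ioi]
  · refine setLIntegral_congr_fun measurableSet_Ioi (fun y hy => ?_)
    have hy : 0 < y := hy
    have : √(y ^ 2 * (1 + t ^ 2) / 2 * (2 / (1 + t ^ 2))) = y := by
      rw [show y ^ 2 * (1 + t ^ 2) / 2 * (2 / (1 + t ^ 2)) = y ^ 2 by field_simp,
        Real.sqrt_sq hy.le]
    simp only [this]
    rw [abs_of_pos (by positivity)]
  · intro y _
    have := (((hasDerivAt_pow 2 y).mul_const (1 + t ^ 2)).div_const 2).hasDerivWithinAt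
      (s := Set.Ioi 0)
    refine this.congr_deriv ?_
    push_cast; ring
  · intro x hx y hy h
    have h : x ^ 2 * (1 + t ^ 2) / 2 = y ^ 2 * (1 + t ^ 2) / 2 := h
    have hx : 0 < x := hx
    have hy : 0 < y := hy
    have : x ^ 2 = y ^ 2 := by
      field_simp at h
      exact h
    exact (pow_left_inj₀ hx.le hy.le two_ne_zero).1 this

theorem hn_inner (y : ℝ) (hy : 0 < y) :
    ∫⁻ t in Set.Ioi (0 : ℝ), ENNReal.ofReal (2 / π * y * Real.exp (-(y ^ 2 * (1 + t ^ 2) / 2)))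
      = ENNReal.ofReal (hnPdf y) := by
  have he : ∀ t : ℝ, 2 / π * y * Real.exp (-(y ^ 2 * (1 + t ^ 2) / 2))
      = 2 / π * y * Real.exp (-y ^ 2 / 2) * Real.exp (-(y ^ 2 / 2) * t ^ 2) := by
    intro t
    rw [mul_assoc _ (Real.exp _), ← Real.exp_add]
    congr 2; ring
  simp_rw [he]
  rw [← ofReal_integral_eq_lintegral_ofReal, integral_const_mul, integral_gaussian_Ioi]
  · congr 1
    rw [hnPdf, show π / (y ^ 2 / 2) = (2 * π) / y ^ 2 by field_simp,
      Real.sqrt_div (by positivity), Real.sqrt_sq hy.le]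
    have : √(2 * π) ≠ 0 := by positivity
    have h2 : √(2 * π) ^ 2 = 2 * π := Real.sq_sqrt (by positivity)
    field_simp
    rw [h2]
  · exact ((integrable_exp_neg_mul_sq (b := y ^ 2 / 2) (by positivity)).const_mul _).integrableOn
  · exact Filter.Eventually.of_forall fun t => by simp only [Pi.zero_apply]; positivity

theorem hn_trig (t : ℝ) : 1 - Real.sin (2 * (arctan t - π / 4)) = 2 / (1 + t ^ 2) := by
  rw [show 2 * (arctan t - π / 4) = 2 * arctan t - π / 2 by ring, Real.sin_sub_pi_div_two,
    Real.cos_two_mul, Real.cos_sq_arctan]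
  ring

theorem hn_main (f : ℝ → ENNReal) (hf : Measurable f) :
    ∫⁻ t, ∫⁻ w, f (√(w * (1 - Real.sin (2 * t)))) ∂(expMeasure 1) ∂(unifOn (-(π / 4)) (π / 4))
      = ∫⁻ y in Set.Ioi (0 : ℝ), ENNReal.ofReal (hnPdf y) * f y := by
  rw [hn_unif]
  have h1 : ∀ t : ℝ, ENNReal.ofReal (2 / π * (1 / (1 + t ^ 2))) *
      (∫⁻ w, f (√(w * (1 - Real.sin (2 * (arctan t - π / 4))))) ∂(expMeasure 1))
      = ∫⁻ y in Set.Ioi (0:ℝ),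
        ENNReal.ofReal (2 / π * y * Real.exp (-(y ^ 2 * (1 + t ^ 2) / 2))) * f y := by
    intro t
    rw [hn_trig, hn_exp _ (by fun_prop), hn_subst,
      ← lintegral_const_mul' _ _ ENNReal.ofReal_ne_top]
    refine setLIntegral_congr_fun measurableSet_Ioi (fun y hy => ?_)
    have hy : 0 < y := hy
    rw [← mul_assoc, ← mul_assoc, ← ENNReal.ofReal_mul (by positivity),
      ← ENNReal.ofReal_mul (by positivity)]
    congr 2
    field_simp
  simp_rw [h1]
  rw [lintegral_lintegral_swap]
  · refine setLIntegral_congr_fun measurableSet_Ioi (fun y hy => ?_)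
    rw [lintegral_mul_const _ (by fun_prop), hn_inner y hy]
  · unfold Function.uncurry
    fun_prop

/-- Key distributional identity for the 2-bit phase-quantized case:
`√(W(1 − sin 2θ))` is half-normal. -/
theorem stmt8
    {Ω : Type*} [MeasurableSpace Ω] (P : Measure Ω) [IsProbabilityMeasure P]
    (W θ : Ω → ℝ) (hW : Measurable W) (hθ : Measurable θ)
    (hWlaw : Measure.map W P = expMeasure 1)
    (hθlaw : Measure.map θ P = unifOn (-(π / 4)) (π / 4))
    (hindep : IndepFun W θ P) :
    (∀ z : ℝ, 0 ≤ z →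
      (P {ω | Real.sqrt (W ω * (1 - Real.sin (2 * θ ω))) ≤ z}).toReal = 1 - 2 * gaussQ z)
    ∧ Measure.map (fun ω => Real.sqrt (W ω * (1 - Real.sin (2 * θ ω)))) P
        = Measure.map (fun g : ℝ => |g|) (gaussianReal 0 1) := by
  have habs : Measurable fun g : ℝ => |g| := measurable_norm
  have hsf : SFinite (unifOn (-(π / 4)) (π / 4)) := by
    rw [← hθlaw]; infer_instance
  have hse : SFinite (expMeasure 1) := by
    rw [← hWlaw]; infer_instance
  have hX : Measurable fun ω => Real.sqrt (W ω * (1 - Real.sin (2 * θ ω))) := by fun_prop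
  have hmap : Measure.map (fun ω => Real.sqrt (W ω * (1 - Real.sin (2 * θ ω)))) P
        = Measure.map (fun g : ℝ => |g|) (gaussianReal 0 1) := by
    refine Measure.ext_of_lintegral _ fun f hf => ?_
    rw [lintegral_map hf hX, lintegral_map hf habs,
      hn_gauss f hf, ← hn_main f hf]
    have hprod := (indepFun_iff_map_prod_eq_prod_map_map hW.aemeasurable hθ.aemeasurable).1 hindep
    rw [hWlaw, hθlaw] at hprod
    have hF : Measurable fun p : ℝ × ℝ => f (√(p.1 * (1 - Real.sin (2 * p.2)))) := by fun_prop
    rw [← lintegral_prod_symm (fun p : ℝ × ℝ => f (√(p.1 * (1 - Real.sin (2 * p.2)))))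
      hF.aemeasurable, ← hprod, lintegral_map hF (hW.prodMk hθ)]
  refine ⟨fun z hz => ?_, hmap⟩
  have hgt : Measure.map (fun g : ℝ => |g|) (gaussianReal 0 1) (Set.Ioi z)
      = ENNReal.ofReal (2 * gaussQ z) := by
    rw [← lintegral_indicator_one measurableSet_Ioi,
      lintegral_map (measurable_one.indicator measurableSet_Ioi)
        habs,
      hn_gauss _ (measurable_one.indicator measurableSet_Ioi)]
    have : ∀ y : ℝ, ENNReal.ofReal (hnPdf y) * (Set.Ioi z).indicator 1 y
        = (Set.Ioi z).indicator (fun y => ENNReal.ofReal (hnPdf y)) y := by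
      intro y
      by_cases hy : y ∈ Set.Ioi z <;> simp [hy]
    simp_rw [this]
    rw [setLIntegral_indicator measurableSet_Ioi,
      Set.inter_eq_left.2 (Set.Ioi_subset_Ioi hz), ← ofReal_integral_eq_lintegral_ofReal]
    · simp only [hnPdf, gaussQ, integral_const_mul]
    · have := ((integrable_exp_neg_mul_sq (b := 1 / 2) (by norm_num)).const_mul
        (√(2 * π))⁻¹).const_mul 2
      refine (this.congr (Filter.Eventually.of_forall fun y => ?_)).integrableOn
      simp only [hnPdf]
      congr 3; ring
    · exact Filter.Eventually.of_forall fun t => by simp only [Pi.zero_apply, hnPdf]; positivity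
  have hQ : 0 ≤ 2 * gaussQ z := by
    unfold gaussQ
    have : 0 ≤ ∫ t in Set.Ioi z, Real.exp (-t ^ 2 / 2) := integral_nonneg fun t => (Real.exp_pos _).le
    positivity
  have hpr : IsProbabilityMeasure
      (Measure.map (fun ω => Real.sqrt (W ω * (1 - Real.sin (2 * θ ω)))) P) :=
    Measure.isProbabilityMeasure_map hX.aemeasurable
  have hset : P {ω | Real.sqrt (W ω * (1 - Real.sin (2 * θ ω))) ≤ z}
      = Measure.map (fun ω => Real.sqrt (W ω * (1 - Real.sin (2 * θ ω)))) P (Set.Ioi z)ᶜ := by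
    rw [Measure.map_apply hX measurableSet_Ioi.compl]
    congr 1; ext ω; simp
  have hle : ENNReal.ofReal (2 * gaussQ z) ≤ 1 := by
    rw [← hgt, ← hmap]; exact prob_le_one
  rw [hset, prob_compl_eq_one_sub measurableSet_Ioi, hmap, hgt,
    ENNReal.toReal_sub_of_le hle ENNReal.one_ne_top, ENNReal.toReal_ofReal hQ, ENNReal.toReal_one]
end

section
/- Let W be an Exp(1) random variable and θ an independent U(−π/2, π/2) random variable. Then for every z ∈ ℝ, P( √(2W) · cos(θ + π/4) ≤ z ) = (Q(−z))²; consequently √(2W)·cos(θ + π/4) has density f(z) = √(2/π) · Q(−z) · e^{−z²/2} on ℝ, and P( √(2W)·cos(θ + π/4) < 0 ) = 1/4. (Distribution of the key statistic Z_i for 1-bit phase quantization, equation (pdf_Z_n1).) -/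
open MeasureTheory ProbabilityTheory Real

open Set Filter Topology in
lemma aux_exp (F : ℝ → ENNReal) (hF : Measurable F) :
    ∫⁻ w, F w ∂(expMeasure 1) =
      ∫⁻ r in Set.Ioi (0:ℝ), ENNReal.ofReal r * (ENNReal.ofReal (rexp (-r ^ 2 / 2)) * F (r ^ 2 / 2)) := by
  have hd : expMeasure 1 = volume.withDensity (exponentialPDF 1) := rfl
  have hm : Measurable (exponentialPDF 1) :=
    (measurable_exponentialPDFReal 1).ennreal_ofReal
  have himg : (fun r : ℝ => r ^ 2 / 2) '' Set.Ioi 0 = Set.Ioi 0 := by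
    ext w
    simp only [Set.mem_image, Set.mem_Ioi]
    constructor
    · rintro ⟨r, hr, rfl⟩; positivity
    · intro hw
      refine ⟨√(2 * w), by positivity, ?_⟩
      rw [Real.sq_sqrt (by positivity)]; ring
  have hinj : Set.InjOn (fun r : ℝ => r ^ 2 / 2) (Set.Ioi 0) := by
    intro a ha b hb hab
    simp only [Set.mem_Ioi] at ha hb hab
    nlinarith
  have h0 : ∫⁻ w, (exponentialPDF 1 * F) w = ∫⁻ w in Set.Ioi (0:ℝ), (exponentialPDF 1 * F) w := by
    rw [setLIntegral_congr (Ioi_ae_eq_Ici (a := (0:ℝ))), ← lintegral_indicator measurableSet_Ici]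
    congr 1
    ext w
    by_cases h : 0 ≤ w
    · rw [Set.indicator_of_mem (by exact h)]
    · rw [Set.indicator_of_notMem (by exact h), Pi.mul_apply,
        exponentialPDF_of_neg (not_le.mp h), zero_mul]
  rw [hd, lintegral_withDensity_eq_lintegral_mul _ hm hF, h0]
  have := lintegral_image_eq_lintegral_abs_deriv_mul (s := Set.Ioi (0:ℝ))
    (f := fun r : ℝ => r ^ 2 / 2) (f' := fun r => r) measurableSet_Ioi
    (fun x _ => by
      have := ((hasDerivAt_pow 2 x).div_const 2)
      refine (this.congr_deriv ?_).hasDerivWithinAt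
      simp) hinj (exponentialPDF 1 * F)
  rw [himg] at this
  rw [this]
  refine setLIntegral_congr_fun measurableSet_Ioi fun r hr => ?_
  have hr : 0 < r := hr
  simp only [Pi.mul_apply]
  rw [exponentialPDF_of_nonneg (by positivity), abs_of_pos hr]
  simp only [one_mul]
  ring_nf

lemma aux_unif (F : ℝ → ENNReal) :
    ∫⁻ t, F (t + π / 4) ∂(unifOn (-(π / 2)) (π / 2)) =
      (ENNReal.ofReal π)⁻¹ * ∫⁻ φ in Set.Ioo (-(π / 4)) (3 * π / 4), F φ := by
  unfold unifOn
  rw [lintegral_smul_measure, smul_eq_mul]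
  congr 1
  · ring_nf
  · rw [← lintegral_indicator measurableSet_Ioo, ← lintegral_indicator measurableSet_Ioo,
      ← lintegral_add_right_eq_self ((Set.Ioo (-(π / 4)) (3 * π / 4)).indicator _) (π / 4)]
    congr 1
    ext t
    have : t ∈ Set.Ioo (-(π / 2)) (π / 2) ↔ t + π / 4 ∈ Set.Ioo (-(π / 4)) (3 * π / 4) := by
      simp only [Set.mem_Ioo]
      constructor <;> rintro ⟨h1, h2⟩ <;> constructor <;> linarith
    by_cases h : t ∈ Set.Ioo (-(π / 2)) (π / 2)
    · rw [Set.indicator_of_mem h, Set.indicator_of_mem (this.mp h)]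
    · rw [Set.indicator_of_notMem h, Set.indicator_of_notMem (fun h' => h (this.mpr h'))]

lemma aux_angle (φ : ℝ) (h : φ ∈ Set.Ioo (-π) π) :
    0 < cos φ + sin φ ↔ φ ∈ Set.Ioo (-(π / 4)) (3 * π / 4) := by
  have e : cos φ + sin φ = √2 * sin (φ + π / 4) := by
    rw [sin_add, cos_pi_div_four, sin_pi_div_four]
    have : √2 * √2 = 2 := Real.mul_self_sqrt (by norm_num)
    linear_combination -(cos φ + sin φ) / 2 * this
  rw [e, mul_pos_iff_of_pos_left (by positivity)]
  obtain ⟨h1, h2⟩ := h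
  constructor
  · intro hs
    constructor
    · by_contra hc
      have := sin_nonpos_of_nonpos_of_neg_pi_le (x := φ + π / 4) (by linarith) (by linarith)
      linarith
    · by_contra hc
      have := sin_nonneg_of_nonneg_of_le_pi (x := φ + π / 4 - π) (by linarith) (by linarith)
      rw [sin_sub_pi] at this
      linarith
  · rintro ⟨h3, h4⟩
    exact sin_pos_of_pos_of_lt_pi (by linarith) (by linarith)

lemma aux_int : Integrable (fun t : ℝ => rexp (-t ^ 2 / 2)) := by
  have := integrable_exp_neg_mul_sq (b := 1 / 2) (by norm_num)
  refine this.congr (Filter.Eventually.of_forall fun t => ?_)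
  simp only; ring_nf

lemma aux_Q (x : ℝ) : ∫⁻ y in Set.Ioi (-x), ENNReal.ofReal (rexp (-y ^ 2 / 2)) =
    ENNReal.ofReal (√(2 * π) * gaussQ (-x)) := by
  rw [← ofReal_integral_eq_lintegral_ofReal aux_int.integrableOn
    (Filter.Eventually.of_forall fun t => (exp_pos _).le)]
  unfold gaussQ
  rw [mul_inv_cancel_left₀ (by positivity)]

lemma gaussQ_nonneg (x : ℝ) : 0 ≤ gaussQ x := by
  unfold gaussQ
  have : 0 ≤ ∫ t in Set.Ioi x, rexp (-t ^ 2 / 2) := integral_nonneg fun t => (exp_pos _).le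
  positivity

lemma aux_main (F : ℝ → ENNReal) (hF : Measurable F) :
    ∫⁻ w, ∫⁻ t, F (√(2 * w) * cos (t + π / 4)) ∂(unifOn (-(π / 2)) (π / 2)) ∂(expMeasure 1) =
    ∫⁻ z, ENNReal.ofReal (√(2 / π) * gaussQ (-z) * rexp (-z ^ 2 / 2)) * F z := by
  have hmeas : Measurable fun p : ℝ × ℝ => F (√(2 * p.1) * cos p.2) := by fun_prop
  have h1 : ∀ w : ℝ, ∫⁻ t, F (√(2 * w) * cos (t + π / 4)) ∂(unifOn (-(π / 2)) (π / 2)) =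
      (ENNReal.ofReal π)⁻¹ * ∫⁻ φ in Set.Ioo (-(π / 4)) (3 * π / 4), F (√(2 * w) * cos φ) :=
    fun w => aux_unif fun φ => F (√(2 * w) * cos φ)
  simp_rw [h1]
  have hm2 : Measurable fun w : ℝ =>
      ∫⁻ φ in Set.Ioo (-(π / 4)) (3 * π / 4), F (√(2 * w) * cos φ) :=
    hmeas.lintegral_prod_right'
  rw [lintegral_const_mul _ hm2, aux_exp _ hm2]
  let G : ℝ × ℝ → ENNReal := fun p => ENNReal.ofReal (rexp (-p.1 ^ 2 / 2)) * F p.1 *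
    (Set.Ioi (-p.1)).indicator (fun y => ENNReal.ofReal (rexp (-y ^ 2 / 2))) p.2
  have hS : MeasurableSet {p : ℝ × ℝ | -p.1 < p.2} :=
    measurableSet_lt (by fun_prop) (by fun_prop)
  have hG : Measurable G := by
    have : G = fun p => ENNReal.ofReal (rexp (-p.1 ^ 2 / 2)) * F p.1 *
        {p : ℝ × ℝ | -p.1 < p.2}.indicator (fun p => ENNReal.ofReal (rexp (-p.2 ^ 2 / 2))) p := by
      ext p; rfl
    rw [this]
    exact (by fun_prop : Measurable fun p : ℝ × ℝ =>
      ENNReal.ofReal (rexp (-p.1 ^ 2 / 2)) * F p.1).mul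
        ((by fun_prop : Measurable fun p : ℝ × ℝ => ENNReal.ofReal (rexp (-p.2 ^ 2 / 2))).indicator hS)
  have hpolar := lintegral_comp_polarCoord_symm G
  have hL : ∫⁻ (p : ℝ × ℝ) in polarCoord.target, ENNReal.ofReal p.1 • G (polarCoord.symm p) =
      ∫⁻ r in Set.Ioi (0:ℝ), ENNReal.ofReal r * (ENNReal.ofReal (rexp (-r ^ 2 / 2)) *
        ∫⁻ φ in Set.Ioo (-(π / 4)) (3 * π / 4), F (√(2 * (r ^ 2 / 2)) * cos φ)) := by
    rw [polarCoord_target, Measure.volume_eq_prod, ← Measure.prod_restrict, lintegral_prod]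
    · refine setLIntegral_congr_fun measurableSet_Ioi fun r hr => ?_
      have hr : 0 < r := hr
      have hmr : Measurable fun φ => F (√(2 * (r ^ 2 / 2)) * cos φ) := by fun_prop
      simp only [polarCoord_symm_apply, smul_eq_mul]
      rw [← lintegral_const_mul _ hmr, ← lintegral_const_mul _ (by fun_prop),
        ← lintegral_indicator measurableSet_Ioo, ← lintegral_indicator measurableSet_Ioo]
      congr 1
      ext φ
      have hsq : √(2 * (r ^ 2 / 2)) = r := by
        rw [show 2 * (r ^ 2 / 2) = r ^ 2 by ring, Real.sqrt_sq hr.le]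
      rw [hsq]
      by_cases hφ : φ ∈ Set.Ioo (-π) π
      · rw [Set.indicator_of_mem hφ]
        have hiff : r * sin φ ∈ Set.Ioi (-(r * cos φ)) ↔ φ ∈ Set.Ioo (-(π / 4)) (3 * π / 4) := by
          rw [← aux_angle φ hφ, Set.mem_Ioi, ← sub_pos,
            show r * sin φ - -(r * cos φ) = r * (cos φ + sin φ) by ring,
            mul_pos_iff_of_pos_left hr]
        by_cases h : φ ∈ Set.Ioo (-(π / 4)) (3 * π / 4)
        · rw [Set.indicator_of_mem h]
          simp only [G]
          rw [Set.indicator_of_mem (hiff.mpr h)]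
          rw [show rexp (-r ^ 2 / 2) = rexp (-(r * cos φ) ^ 2 / 2) * rexp (-(r * sin φ) ^ 2 / 2) by
            rw [← Real.exp_add]; congr 1
            linear_combination (r ^ 2 / 2) * sin_sq_add_cos_sq φ]
          rw [ENNReal.ofReal_mul (exp_pos _).le]
          ring
        · rw [Set.indicator_of_notMem h]
          simp only [G]
          rw [Set.indicator_of_notMem (fun h' => h (hiff.mp h'))]
          simp
      · rw [Set.indicator_of_notMem hφ, Set.indicator_of_notMem]
        intro h
        exact hφ ⟨by linarith [h.1, pi_pos], by linarith [h.2, pi_pos]⟩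
    · have : Measurable fun p : ℝ × ℝ => ENNReal.ofReal p.1 • G (polarCoord.symm p) := by
        simp only [polarCoord_symm_apply, smul_eq_mul]
        exact (by fun_prop : Measurable fun p : ℝ × ℝ => ENNReal.ofReal p.1).mul
          (hG.comp (by fun_prop : Measurable fun p : ℝ × ℝ => (p.1 * cos p.2, p.1 * sin p.2)))
      exact this.aemeasurable
  rw [← hL, hpolar, Measure.volume_eq_prod, lintegral_prod _ hG.aemeasurable,
    ← lintegral_const_mul _ hG.lintegral_prod_right']
  congr 1
  ext x
  simp only [G]
  rw [lintegral_const_mul _ ((by fun_prop : Measurable fun y : ℝ =>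
    ENNReal.ofReal (rexp (-y ^ 2 / 2))).indicator measurableSet_Ioi),
    lintegral_indicator measurableSet_Ioi, aux_Q,
    ← ENNReal.ofReal_inv_of_pos pi_pos]
  have hs : √(2 / π) = π⁻¹ * √(2 * π) := by
    rw [Real.sqrt_eq_iff_mul_self_eq (by positivity) (by positivity)]
    have := Real.mul_self_sqrt (show 0 ≤ 2 * π by positivity)
    field_simp
    linarith
  rw [hs, show π⁻¹ * √(2 * π) * gaussQ (-x) * rexp (-x ^ 2 / 2) =
    π⁻¹ * (rexp (-x ^ 2 / 2) * (√(2 * π) * gaussQ (-x))) by ring,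
    ENNReal.ofReal_mul (p := π⁻¹) (by positivity), ENNReal.ofReal_mul (exp_pos _).le]
  ring

lemma gaussQ_neg_eq (z : ℝ) :
    gaussQ (-z) = (√(2 * π))⁻¹ * ∫ t in Set.Iic z, rexp (-t ^ 2 / 2) := by
  unfold gaussQ
  rw [← integral_comp_neg_Iic]
  simp

lemma gaussQ_neg_hasDerivAt (z : ℝ) :
    HasDerivAt (fun z => gaussQ (-z)) ((√(2 * π))⁻¹ * rexp (-z ^ 2 / 2)) z := by
  have h : (fun z => gaussQ (-z)) = fun z => (√(2 * π))⁻¹ *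
      ((∫ t in Set.Iic 0, rexp (-t ^ 2 / 2)) + ∫ t in (0:ℝ)..z, rexp (-t ^ 2 / 2)) := by
    ext z
    rw [gaussQ_neg_eq, ← intervalIntegral.integral_Iic_sub_Iic aux_int.integrableOn
      aux_int.integrableOn]
    ring
  rw [h]
  have hc : Continuous fun t : ℝ => rexp (-t ^ 2 / 2) := by fun_prop
  exact ((hc.integral_hasStrictDerivAt 0 z).hasDerivAt.const_add _).const_mul _

lemma gaussQ_neg_tendsto : Filter.Tendsto (fun z => gaussQ (-z)) Filter.atBot (nhds 0) := by
  have h : (fun z => gaussQ (-z)) = fun z => (√(2 * π))⁻¹ *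
      ((∫ t in Set.Iic 0, rexp (-t ^ 2 / 2)) - ∫ t in z..(0:ℝ), rexp (-t ^ 2 / 2)) := by
    ext z
    rw [gaussQ_neg_eq, ← intervalIntegral.integral_Iic_sub_Iic aux_int.integrableOn
      aux_int.integrableOn]
    ring
  rw [h]
  have := intervalIntegral_tendsto_integral_Iic (μ := volume) (l := Filter.atBot)
    (a := fun z : ℝ => z) (0:ℝ) (f := fun t : ℝ => rexp (-t ^ 2 / 2)) aux_int.integrableOn Filter.tendsto_id
  have key := (this.const_sub (∫ t in Set.Iic (0:ℝ), rexp (-t ^ 2 / 2))).const_mul (√(2 * π))⁻¹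
  have h0 : (√(2 * π))⁻¹ * ((∫ t in Set.Iic (0:ℝ), rexp (-t ^ 2 / 2)) -
      ∫ t in Set.Iic (0:ℝ), rexp (-t ^ 2 / 2)) = 0 := by rw [sub_self, mul_zero]
  convert key using 2
  exact h0.symm

lemma gaussQ_neg_continuous : Continuous fun z => gaussQ (-z) :=
  continuous_iff_continuousAt.mpr fun z => (gaussQ_neg_hasDerivAt z).continuousAt

lemma gaussQ_zero : gaussQ 0 = 1 / 2 := by
  unfold gaussQ
  have := integral_gaussian_Ioi (1 / 2)
  have e : ∀ t : ℝ, -t ^ 2 / 2 = -(1 / 2) * t ^ 2 := fun t => by ring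
  simp_rw [e]
  rw [this, show π / (1 / 2) = 2 * π by ring]
  have : √(2 * π) ≠ 0 := by positivity
  field_simp

lemma sqrt_two_div_pi : √(2 / π) = 2 * (√(2 * π))⁻¹ := by
  rw [Real.sqrt_eq_iff_mul_self_eq (by positivity) (by positivity)]
  have := Real.mul_self_sqrt (show 0 ≤ 2 * π by positivity)
  have h0 : √(2 * π) ≠ 0 := by positivity
  field_simp
  nlinarith

lemma dens_integrable :
    IsFiniteMeasure (volume.withDensity
      (fun z => ENNReal.ofReal (√(2 / π) * gaussQ (-z) * rexp (-z ^ 2 / 2)))) →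
    Integrable fun z => √(2 / π) * gaussQ (-z) * rexp (-z ^ 2 / 2) := by
  intro h
  have hc := gaussQ_neg_continuous
  have hm : Continuous fun z => √(2 / π) * gaussQ (-z) * rexp (-z ^ 2 / 2) := by fun_prop
  have hn : ∀ z, 0 ≤ √(2 / π) * gaussQ (-z) * rexp (-z ^ 2 / 2) := fun z => by
    have := gaussQ_nonneg (-z)
    positivity
  refine ⟨hm.aestronglyMeasurable, ?_⟩
  rw [hasFiniteIntegral_iff_ofReal (Filter.Eventually.of_forall hn)]
  have := h.measure_univ_lt_top
  rwa [withDensity_apply _ MeasurableSet.univ, setLIntegral_univ] at this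

/-- Distribution of the key statistic `Z = √(2W)·cos(θ + π/4)` for 1-bit phase
quantization: CDF `(Q(−z))²`, the stated density, and `P(Z < 0) = 1/4`. -/
theorem stmt9
    {Ω : Type*} [MeasurableSpace Ω] (P : Measure Ω) [IsProbabilityMeasure P]
    (W θ : Ω → ℝ) (hW : Measurable W) (hθ : Measurable θ)
    (hWlaw : Measure.map W P = expMeasure 1)
    (hθlaw : Measure.map θ P = unifOn (-(π / 2)) (π / 2))
    (hindep : IndepFun W θ P)
    (Z : Ω → ℝ) (hZ : Z = fun ω => Real.sqrt (2 * W ω) * Real.cos (θ ω + π / 4)) :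
    (∀ z : ℝ, (P {ω | Z ω ≤ z}).toReal = gaussQ (-z) ^ 2)
    ∧ Measure.map Z P
        = volume.withDensity
            (fun z => ENNReal.ofReal (Real.sqrt (2 / π) * gaussQ (-z) * Real.exp (-z ^ 2 / 2)))
    ∧ (P {ω | Z ω < 0}).toReal = 1 / 4 := by
  have hZm : Measurable Z := by rw [hZ]; fun_prop
  have hprod := (indepFun_iff_map_prod_eq_prod_map_map hW.aemeasurable hθ.aemeasurable).mp hindep
  have hsf : SFinite (unifOn (-(π / 2)) (π / 2)) := by
    rw [← hθlaw]; infer_instance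
  have hlaw : Measure.map Z P = volume.withDensity
      (fun z => ENNReal.ofReal (√(2 / π) * gaussQ (-z) * rexp (-z ^ 2 / 2))) := by
    ext s hs
    have hi : Measurable (s.indicator (1 : ℝ → ENNReal)) := measurable_one.indicator hs
    have hcomp : Measurable fun p : ℝ × ℝ =>
      s.indicator (1 : ℝ → ENNReal) (√(2 * p.1) * cos (p.2 + π / 4)) := by fun_prop
    have e1 : Measure.map Z P s = ∫⁻ p, s.indicator (1 : ℝ → ENNReal)
        (√(2 * p.1) * cos (p.2 + π / 4)) ∂(Measure.map (fun ω => (W ω, θ ω)) P) := by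
      rw [lintegral_map hcomp (hW.prodMk hθ), ← lintegral_indicator_one hs,
        lintegral_map hi hZm, hZ]
    rw [e1, hprod, hWlaw, hθlaw, lintegral_prod _ hcomp.aemeasurable, aux_main _ hi,
      withDensity_apply _ hs, ← lintegral_indicator hs]
    congr 1
    ext z
    by_cases h : z ∈ s <;> simp [h]
  have hfin : IsFiniteMeasure (volume.withDensity
      (fun z => ENNReal.ofReal (√(2 / π) * gaussQ (-z) * rexp (-z ^ 2 / 2)))) := by
    rw [← hlaw]; infer_instance
  have hint := dens_integrable hfin
  have hcdf : ∀ z : ℝ, (P {ω | Z ω ≤ z}).toReal = gaussQ (-z) ^ 2 := by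
    intro z
    have e : P {ω | Z ω ≤ z} = Measure.map Z P (Set.Iic z) := by
      rw [Measure.map_apply hZm measurableSet_Iic]; rfl
    rw [e, hlaw, withDensity_apply _ measurableSet_Iic,
      ← ofReal_integral_eq_lintegral_ofReal hint.integrableOn
        (Filter.Eventually.of_forall fun z => by
          have := gaussQ_nonneg (-z)
          positivity)]
    have := integral_Iic_of_hasDerivAt_of_tendsto' (a := z) (m := 0)
      (f := fun z => gaussQ (-z) ^ 2)
      (f' := fun z => √(2 / π) * gaussQ (-z) * rexp (-z ^ 2 / 2))
      (fun x _ => ((gaussQ_neg_hasDerivAt x).pow 2).congr_deriv (by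
        rw [sqrt_two_div_pi]; push_cast; ring))
      hint.integrableOn (by simpa using gaussQ_neg_tendsto.pow 2)
    rw [this, sub_zero, ENNReal.toReal_ofReal (by positivity)]
  refine ⟨hcdf, hlaw, ?_⟩
  have e : P {ω | Z ω < 0} = P {ω | Z ω ≤ 0} := by
    have e1 : P {ω | Z ω ≤ 0} = Measure.map Z P (Set.Iic 0) := by
      rw [Measure.map_apply hZm measurableSet_Iic]; rfl
    have e2 : P {ω | Z ω < 0} = Measure.map Z P (Set.Iio 0) := by
      rw [Measure.map_apply hZm measurableSet_Iio]; rfl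
    rw [e1, e2, hlaw, withDensity_apply _ measurableSet_Iic, withDensity_apply _ measurableSet_Iio]
    exact setLIntegral_congr Iio_ae_eq_Iic
  rw [e, hcdf, neg_zero, gaussQ_zero]
  norm_num
end
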